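/- 2^{1/3} · P(1/3, 7/6) = (2 − √3) · P(2/3, 5/6), and (2 − √3) · P(2/3, 5/6) = √3 · P(2/3, 4/3). -/

import Mathlib

open Real

/-- Ascending Pochhammer symbol `(x)_k = x(x+1)⋯(x+k−1)`. -/
noncomputable def poch (x : ℝ) (k : ℕ) : ℝ := (ascPochhammer ℝ k).eval x

/-- The Beta function quotient `B(x,y) = Γ(x)Γ(y)/Γ(x+y)`. -/
noncomputable def betaR (x y : ℝ) : ℝ := Gamma x * Gamma y / Gamma (x + y)

/-- Generalized hypergeometric series `₃F₂(a₁,a₂,a₃; b₁,b₂; z)`. -/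
noncomputable def F32 (a1 a2 a3 b1 b2 z : ℝ) : ℝ :=
  ∑' k : ℕ, (poch a1 k * poch a2 k * poch a3 k)
      / (poch b1 k * poch b2 k * (k.factorial : ℝ)) * z ^ k

/-- The hypergeometric period value `P(r,s) = π · B(r, s−r) · ₃F₂(1/2,1/2,r; 1,s; 1)`. -/
noncomputable def P (r s : ℝ) : ℝ := π * betaR r (s - r) * F32 (1/2) (1/2) r 1 s 1

open Finset Filter Topology

theorem poch_zero (x : ℝ) : poch x 0 = 1 := by simp [poch]

theorem poch_succ (x : ℝ) (k : ℕ) : poch x (k + 1) = poch x k * (x + k) := by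
  simp [poch, ascPochhammer_succ_eval]

theorem poch_pos {x : ℝ} (hx : 0 < x) (k : ℕ) : 0 < poch x k :=
  ascPochhammer_pos k x hx

theorem poch_add_one (x : ℝ) (k : ℕ) : x * poch (x + 1) k = poch x k * (x + k) := by
  induction k with
  | zero => simp [poch_zero]
  | succ k ih =>
    rw [poch_succ, ← mul_assoc, ih, poch_succ]
    push_cast
    ring

theorem poch_add_two (x : ℝ) (k : ℕ) :
    x * (x + 1) * poch (x + 2) k = poch x k * (x + k) * (x + k + 1) := by
  have h := poch_add_one (x + 1) k
  rw [add_assoc, one_add_one_eq_two] at h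
  rw [mul_assoc, h, ← mul_assoc, poch_add_one]
  ring

theorem poch_one (k : ℕ) : poch 1 k = (k.factorial : ℝ) := by
  simp [poch, ascPochhammer_eval_one]

theorem poch_mono {x y : ℝ} (hx : 0 < x) (hxy : x ≤ y) (k : ℕ) : poch x k ≤ poch y k := by
  induction k with
  | zero => simp [poch_zero]
  | succ k ih =>
    rw [poch_succ, poch_succ]
    have := poch_pos hx k
    have := poch_pos (hx.trans_le hxy) k
    gcongr

theorem Gamma_add_nat {x : ℝ} (hx : 0 < x) (k : ℕ) : Gamma (x + k) = Gamma x * poch x k := by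
  induction k with
  | zero => simp [poch_zero]
  | succ k ih =>
    rw [Nat.cast_succ, ← add_assoc, Gamma_add_one (by positivity), ih, poch_succ]
    ring

theorem tendsto_Gamma_add_nat {x : ℝ} (hx : 0 < x) :
    Tendsto (fun k : ℕ => Gamma (x + k) / (k.factorial * (k : ℝ) ^ (x - 1))) atTop (𝓝 1) := by
  have hG := (Gamma_pos_of_pos hx).ne'
  have hfrac : Tendsto (fun k : ℕ => (k : ℝ) / (k + x)) atTop (𝓝 1) :=
    tendsto_natCast_div_add_atTop x
  have hlim := ((tendsto_const_nhds (x := Gamma x)).div (GammaSeq_tendsto_Gamma x) hG).mul hfrac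
  rw [div_self hG, one_mul] at hlim
  refine hlim.congr' ?_
  filter_upwards [eventually_ge_atTop 1] with k hk
  have hk' : (0 : ℝ) < k := by exact_mod_cast hk
  have hprod : ∏ j ∈ range (k + 1), (x + j) = poch x (k + 1) := by
    generalize k + 1 = m
    induction m with
    | zero => simp [poch_zero]
    | succ m ih => rw [prod_range_succ, ih, poch_succ]
  have hp := poch_pos hx k
  have hpow : (0 : ℝ) < (k : ℝ) ^ x := by positivity
  simp only [Pi.div_apply]
  rw [GammaSeq, hprod, poch_succ, Gamma_add_nat hx, rpow_sub_one hk'.ne']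
  field_simp
  ring

theorem tendsto_Gamma_ratio {a b c d : ℝ} (ha : 0 < a) (hb : 0 < b) (hc : 0 < c) (hd : 0 < d)
    (h : a + b = c + d) :
    Tendsto (fun k : ℕ => Gamma (a + k) * Gamma (b + k) / (Gamma (c + k) * Gamma (d + k)))
      atTop (𝓝 1) := by
  have hlim := ((tendsto_Gamma_add_nat ha).mul (tendsto_Gamma_add_nat hb)).div
    ((tendsto_Gamma_add_nat hc).mul (tendsto_Gamma_add_nat hd)) (by norm_num)
  rw [one_mul, div_one] at hlim
  refine hlim.congr' ?_
  filter_upwards [eventually_ge_atTop 1] with k hk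
  have hk' : (0 : ℝ) < k := by exact_mod_cast hk
  have hpow : (k : ℝ) ^ (a - 1) * (k : ℝ) ^ (b - 1) = (k : ℝ) ^ (c - 1) * (k : ℝ) ^ (d - 1) := by
    rw [← rpow_add hk', ← rpow_add hk']
    congr 1
    linarith
  have hC : 0 < Gamma (c + k) := Gamma_pos_of_pos (by positivity)
  have hD : 0 < Gamma (d + k) := Gamma_pos_of_pos (by positivity)
  have h1 : (0 : ℝ) < (k : ℝ) ^ (a - 1) := by positivity
  have h2 : (0 : ℝ) < (k : ℝ) ^ (b - 1) := by positivity
  have h3 : (0 : ℝ) < (k : ℝ) ^ (c - 1) := by positivity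
  have h4 : (0 : ℝ) < (k : ℝ) ^ (d - 1) := by positivity
  simp only [Pi.div_apply]
  rw [div_mul_div_comm, div_mul_div_comm, div_div_div_eq, div_eq_div_iff (by positivity)
    (by positivity)]
  linear_combination (-(Gamma (a + k) * Gamma (b + k) * Gamma (c + k) * Gamma (d + k)
    * (k.factorial : ℝ) ^ 2)) * hpow

/-- The `k`-th term of the series `₃F₂(x, y, z; e, f; 1)`. -/
noncomputable def hyperTerm (x y z e f : ℝ) (k : ℕ) : ℝ :=
  poch x k * poch y k * poch z k / (poch e k * poch f k * k.factorial)

section HyperTerm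

variable {x y z e f : ℝ}

theorem hyperTerm_pos (hx : 0 < x) (hy : 0 < y) (hz : 0 < z) (he : 0 < e) (hf : 0 < f) (k : ℕ) :
    0 < hyperTerm x y z e f k := by
  have := poch_pos hx k
  have := poch_pos hy k
  have := poch_pos hz k
  have := poch_pos he k
  have := poch_pos hf k
  unfold hyperTerm
  positivity

theorem hyperTerm_succ (k : ℕ) :
    hyperTerm x y z e f (k + 1) =
      hyperTerm x y z e f k * ((x + k) * (y + k) * (z + k) / ((e + k) * (f + k) * (k + 1))) := by
  simp only [hyperTerm, poch_succ, Nat.factorial_succ]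
  push_cast
  rw [div_mul_div_comm]
  congr 1 <;> ring

theorem hyperTerm_add_two (hx : 0 < x) (he : 0 < e) (hf : 0 < f) (k : ℕ) :
    hyperTerm (x + 2) y z (e + 2) (f + 2) k =
      hyperTerm x y z e f k * (e * (e + 1) * f * (f + 1) / (x * (x + 1)) *
        ((x + k) * (x + k + 1)) / ((e + k) * (e + k + 1) * (f + k) * (f + k + 1))) := by
  have hX : poch (x + 2) k = poch x k * (x + k) * (x + k + 1) / (x * (x + 1)) := by
    rw [← poch_add_two]; field_simp
  have hE : poch (e + 2) k = poch e k * (e + k) * (e + k + 1) / (e * (e + 1)) := by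
    rw [← poch_add_two]; field_simp
  have hF : poch (f + 2) k = poch f k * (f + k) * (f + k + 1) / (f * (f + 1)) := by
    rw [← poch_add_two]; field_simp
  have := poch_pos he k
  have := poch_pos hf k
  rw [hyperTerm, hyperTerm, hX, hE, hF]
  field_simp

theorem tendsto_hyperTerm_mul_rpow (hx : 0 < x) (hy : 0 < y) (hz : 0 < z) (he : 0 < e)
    (hf : 0 < f) :
    ∃ C, Tendsto (fun k : ℕ => hyperTerm x y z e f k * (k : ℝ) ^ (e + f + 1 - x - y - z))
      atTop (𝓝 C) := by
  have hlim := ((((tendsto_Gamma_add_nat hx).mul (tendsto_Gamma_add_nat hy)).mul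
    (tendsto_Gamma_add_nat hz)).div ((tendsto_Gamma_add_nat he).mul (tendsto_Gamma_add_nat hf))
    (by norm_num)).mul_const (Gamma e * Gamma f / (Gamma x * Gamma y * Gamma z))
  refine ⟨_, hlim.congr' ?_⟩
  filter_upwards [eventually_ge_atTop 1] with k hk
  have hk' : (0 : ℝ) < k := by exact_mod_cast hk
  have hX := Gamma_pos_of_pos hx
  have hY := Gamma_pos_of_pos hy
  have hZ := Gamma_pos_of_pos hz
  have hE := Gamma_pos_of_pos he
  have hF := Gamma_pos_of_pos hf
  have hpe := poch_pos he k
  have hpf := poch_pos hf k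
  have h1 : (0 : ℝ) < (k : ℝ) ^ (x - 1) := by positivity
  have h2 : (0 : ℝ) < (k : ℝ) ^ (y - 1) := by positivity
  have h3 : (0 : ℝ) < (k : ℝ) ^ (z - 1) := by positivity
  have hpow : (k : ℝ) ^ (e + f + 1 - x - y - z) =
      (k : ℝ) ^ (e - 1) * (k : ℝ) ^ (f - 1) /
        ((k : ℝ) ^ (x - 1) * (k : ℝ) ^ (y - 1) * (k : ℝ) ^ (z - 1)) := by
    rw [← rpow_add hk', ← rpow_add hk', ← rpow_add hk', ← rpow_sub hk']
    congr 1
    ring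
  simp only [Pi.div_apply]
  rw [hpow, hyperTerm, Gamma_add_nat hx, Gamma_add_nat hy, Gamma_add_nat hz, Gamma_add_nat he,
    Gamma_add_nat hf]
  field_simp

theorem summable_hyperTerm (hx : 0 < x) (hy : 0 < y) (hz : 0 < z) (he : 0 < e) (hf : 0 < f)
    (h : x + y + z < e + f) : Summable (hyperTerm x y z e f) := by
  obtain ⟨C, hC⟩ := tendsto_hyperTerm_mul_rpow hx hy hz he hf
  have hsum : Summable fun k : ℕ => 1 / (k : ℝ) ^ (e + f + 1 - x - y - z) :=
    summable_one_div_nat_rpow.2 (by linarith)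
  refine summable_of_isBigO_nat hsum ?_
  have hO := (hC.isBigO_one ℝ).mul
    (Asymptotics.isBigO_refl (fun k : ℕ => 1 / (k : ℝ) ^ (e + f + 1 - x - y - z)) atTop)
  refine hO.congr' ?_ ?_
  · filter_upwards [eventually_ge_atTop 1] with k hk
    have hk' : (0 : ℝ) < k := by exact_mod_cast hk
    have : (0 : ℝ) < (k : ℝ) ^ (e + f + 1 - x - y - z) := by positivity
    field_simp
  · exact Eventually.of_forall fun k => by simp

theorem tendsto_nat_mul_hyperTerm (hx : 0 < x) (hy : 0 < y) (hz : 0 < z) (he : 0 < e)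
    (hf : 0 < f) (h : x + y + z < e + f) :
    Tendsto (fun k : ℕ => k * hyperTerm x y z e f k) atTop (𝓝 0) := by
  obtain ⟨C, hC⟩ := tendsto_hyperTerm_mul_rpow hx hy hz he hf
  have hneg : Tendsto (fun k : ℕ => (k : ℝ) ^ (-(e + f - x - y - z))) atTop (𝓝 0) :=
    (tendsto_rpow_neg_atTop (by linarith)).comp tendsto_natCast_atTop_atTop
  have hlim := hC.mul hneg
  rw [mul_zero] at hlim
  refine hlim.congr' ?_
  filter_upwards [eventually_ge_atTop 1] with k hk
  have hk' : (0 : ℝ) < k := by exact_mod_cast hk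
  rw [mul_assoc, ← rpow_add hk', show e + f + 1 - x - y - z + -(e + f - x - y - z) = 1 by ring,
    rpow_one, mul_comm]

/-- Creative telescoping: a certificate `q` for the shift of `x`, `e`, `f` by two, of the form
`q k = C (k + e) (k + f) + B (k + e) + A`, gives a first-order recurrence for the sums. -/
theorem tsum_hyperTerm_add_two (hx : 0 < x) (hy : 0 < y) (hz : 0 < z) (he : 0 < e) (hf : 0 < f)
    (h : x + y + z < e + f) (ρ A B C : ℝ)
    (hq : ∀ k : ℝ, e * (e + 1) * f * (f + 1) / (x * (x + 1)) * ((x + k) * (x + k + 1))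
        - ρ * ((e + k) * (e + k + 1) * (f + k) * (f + k + 1)) =
      (x + k) * (y + k) * (z + k) * (C * (k + 1 + e) * (k + 1 + f) + B * (k + 1 + e) + A)
        - k * (e + k + 1) * (f + k + 1) * (C * (k + e) * (k + f) + B * (k + e) + A)) :
    ∑' k, hyperTerm (x + 2) y z (e + 2) (f + 2) k = ρ * ∑' k, hyperTerm x y z e f k := by
  have hs := summable_hyperTerm hx hy hz he hf h
  have hs' : Summable (hyperTerm (x + 2) y z (e + 2) (f + 2)) :=
    summable_hyperTerm (by linarith) hy hz (by linarith) (by linarith) (by linarith)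
  let G : ℕ → ℝ := fun k =>
    k * hyperTerm x y z e f k * (C + B / (k + f) + A / ((k + e) * (k + f)))
  have hstep : ∀ k : ℕ, hyperTerm (x + 2) y z (e + 2) (f + 2) k - ρ * hyperTerm x y z e f k =
      G (k + 1) - G k := by
    intro k
    simp only [G]
    rw [hyperTerm_add_two hx he hf, hyperTerm_succ]
    have hk := hq k
    push_cast
    have hκ : (0 : ℝ) ≤ k := k.cast_nonneg
    generalize (k : ℝ) = κ at hk hκ ⊢
    generalize e * (e + 1) * f * (f + 1) / (x * (x + 1)) = α at hk ⊢
    trans hyperTerm x y z e f k * ((α * ((x + κ) * (x + κ + 1))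
      - ρ * ((e + κ) * (e + κ + 1) * (f + κ) * (f + κ + 1)))
        / ((e + κ) * (e + κ + 1) * (f + κ) * (f + κ + 1)))
    · field_simp
    · rw [hk, add_comm e κ, add_comm f κ]
      field_simp
      ring
  have hG : Tendsto G atTop (𝓝 0) := by
    have hinv : ∀ c : ℝ, Tendsto (fun k : ℕ => ((k : ℝ) + c)⁻¹) atTop (𝓝 0) := fun c =>
      (tendsto_natCast_atTop_atTop.atTop_add tendsto_const_nhds).inv_tendsto_atTop
    have hb := ((tendsto_const_nhds (x := C)).add ((hinv f).const_mul B)).add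
      (((hinv e).mul (hinv f)).const_mul A)
    have hlim := (tendsto_nat_mul_hyperTerm hx hy hz he hf h).mul hb
    rw [zero_mul] at hlim
    refine hlim.congr fun k => ?_
    simp only [G, div_eq_mul_inv, mul_inv]
  have hpartial := (hs'.sub (hs.mul_left ρ)).hasSum.tendsto_sum_nat
  have hzero : Tendsto (fun n => ∑ k ∈ range n,
      (hyperTerm (x + 2) y z (e + 2) (f + 2) k - ρ * hyperTerm x y z e f k)) atTop (𝓝 0) := by
    refine hG.congr fun n => ?_
    rw [sum_congr rfl fun k _ => hstep k, sum_range_sub]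
    simp [G]
  have := tendsto_nhds_unique hpartial hzero
  rw [hs'.tsum_sub (hs.mul_left ρ), tsum_mul_left] at this
  linarith

theorem hyperTerm_le (hx : 0 < x) (hy : 0 < y) (hz : 0 < z) (hxe : x ≤ e) (hz1 : z ≤ 1)
    (hf : 0 < f) (k : ℕ) : hyperTerm x y z e f k ≤ poch y k / poch f k := by
  have hX := poch_pos hx k
  have hY := poch_pos hy k
  have hZ := poch_pos hz k
  have hE := poch_pos (hx.trans_le hxe) k
  have hF := poch_pos hf k
  have h1 := poch_mono hx hxe k
  have h2 := poch_mono hz hz1 k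
  rw [poch_one] at h2
  rw [hyperTerm, div_le_div_iff₀ (by positivity) hF]
  calc poch x k * poch y k * poch z k * poch f k
      = poch y k * poch f k * (poch x k * poch z k) := by ring
    _ ≤ poch y k * poch f k * (poch e k * k.factorial) := by gcongr
    _ = poch y k * (poch e k * poch f k * k.factorial) := by ring

theorem le_poch_succ {x : ℝ} (hx : 0 < x) (k : ℕ) : x ≤ poch x (k + 1) := by
  have h : x * 1 ≤ x * poch (x + 1) k := by
    gcongr
    have := poch_mono one_pos (by linarith : 1 ≤ x + 1) k
    rw [poch_one] at this
    exact le_trans (by exact_mod_cast k.factorial_pos) this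
  rw [poch_add_one, mul_one, ← poch_succ] at h
  exact h

theorem poch_div_poch_le {y f : ℝ} (hy : 0 < y) (hy1 : y ≤ 1) (hf : 3 ≤ f) (k : ℕ) :
    poch y k / poch f k ≤ 2 * (1 / ((k + 1 : ℕ) : ℝ) ^ 2) := by
  have h1 := poch_mono hy hy1 k
  have h3 := poch_mono three_pos hf k
  have hp := poch_pos one_pos k
  have h13 := poch_add_two 1 k
  rw [show (1 : ℝ) + 2 = 3 by norm_num] at h13
  have : poch y k / poch f k ≤ poch 1 k / poch 3 k := by
    have := poch_pos three_pos k
    gcongr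
  refine this.trans ?_
  rw [show poch 3 k = poch 1 k * (1 + k) * (1 + k + 1) / 2 by linarith]
  push_cast
  rw [mul_one_div, div_le_div_iff₀ (by positivity) (by positivity)]
  nlinarith [mul_pos hp (by positivity : (0 : ℝ) < 1 + k)]

theorem tendsto_tsum_hyperTerm (hx : 0 < x) (hy : 0 < y) (hz : 0 < z) (hxe : x ≤ e) (hy1 : y ≤ 1)
    (hz1 : z ≤ 1) (hf : 0 < f) :
    Tendsto (fun n : ℕ => ∑' k, hyperTerm (x + 2 * n) y z (e + 2 * n) (f + 2 * n) k)
      atTop (𝓝 1) := by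
  have he := hx.trans_le hxe
  have hsum : Summable fun k : ℕ => 2 * (1 / ((k + 1 : ℕ) : ℝ) ^ 2) :=
    ((summable_nat_add_iff 1).2 (Real.summable_one_div_nat_pow.2 one_lt_two)).mul_left 2
  have hle : ∀ n k : ℕ, hyperTerm (x + 2 * n) y z (e + 2 * n) (f + 2 * n) k ≤
      poch y k / poch (f + 2 * n) k := fun n k =>
    hyperTerm_le (by positivity) hy hz (by linarith) hz1 (by positivity) k
  have hpos : ∀ n k : ℕ, 0 < hyperTerm (x + 2 * n) y z (e + 2 * n) (f + 2 * n) k := fun n k =>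
    hyperTerm_pos (by positivity) hy hz (by positivity) (by positivity) k
  have hlim := tendsto_tsum_of_dominated_convergence hsum (𝓕 := atTop)
    (f := fun n k => hyperTerm (x + 2 * (n : ℕ)) y z (e + 2 * n) (f + 2 * n) k)
    (g := fun k => if k = 0 then 1 else 0) ?_ ?_
  · simpa using hlim
  · intro k
    rcases k with _ | k
    · simp [hyperTerm, poch_zero]
    · simp only [Nat.add_eq_zero_iff, one_ne_zero, and_false, if_false]
      have hdiv : Tendsto (fun n : ℕ => poch y (k + 1) / (f + 2 * (n : ℝ))) atTop (𝓝 0) :=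
        tendsto_const_nhds.div_atTop
          (tendsto_const_nhds.add_atTop (tendsto_natCast_atTop_atTop.const_mul_atTop two_pos))
      refine squeeze_zero (fun n => (hpos n _).le) (fun n => (hle n _).trans ?_) hdiv
      have := poch_pos hy (k + 1)
      have hfn : 0 < f + 2 * (n : ℝ) := by positivity
      have := le_poch_succ hfn k
      gcongr
  · filter_upwards [eventually_ge_atTop 2] with n hn k
    have hn' : (2 : ℝ) ≤ n := by exact_mod_cast hn
    rw [Real.norm_of_nonneg (hpos n k).le]
    exact (hle n k).trans (poch_div_poch_le hy hy1 (by linarith) k)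

theorem tsum_hyperTerm_eq (hx : 0 < x) (hy : 0 < y) (hz : 0 < z) (hxe : x ≤ e) (hy1 : y ≤ 1)
    (hz1 : z ≤ 1) (hf : 0 < f) (H : ℕ → ℝ) (hH : ∀ n, H n ≠ 0) (hlim : Tendsto H atTop (𝓝 1))
    (hrec : ∀ n : ℕ, ∑' k, hyperTerm (x + 2 * n + 2) y z (e + 2 * n + 2) (f + 2 * n + 2) k =
      H (n + 1) / H n * ∑' k, hyperTerm (x + 2 * n) y z (e + 2 * n) (f + 2 * n) k) :
    ∑' k, hyperTerm x y z e f k = H 0 := by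
  set S : ℕ → ℝ := fun n => ∑' k, hyperTerm (x + 2 * n) y z (e + 2 * n) (f + 2 * n) k with hS
  have hS0 : S 0 = ∑' k, hyperTerm x y z e f k := by simp [hS]
  have hconst : ∀ n, S n / H n = S 0 / H 0 := by
    intro n
    induction n with
    | zero => rfl
    | succ n ih =>
      have : S (n + 1) = H (n + 1) / H n * S n := by
        rw [← hrec n]
        simp only [hS]
        push_cast
        simp only [mul_add, mul_one, add_assoc]
      rw [← ih, this]
      field_simp [hH n, hH (n + 1)]
  have h1 : Tendsto (fun n => S n / H n) atTop (𝓝 (1 / 1)) :=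
    (tendsto_tsum_hyperTerm hx hy hz hxe hy1 hz1 hf).div hlim one_ne_zero
  have h2 : Tendsto (fun n => S n / H n) atTop (𝓝 (S 0 / H 0)) := by simp [hconst]
  have h3 := tendsto_nhds_unique h2 h1
  rw [div_one, div_eq_one_iff_eq (hH 0)] at h3
  rw [← hS0, h3]

end HyperTerm

theorem dixon_certificate {x c : ℝ} (hx : 0 < x) (hc : 0 < c) (hcx : 2 * c < x + 1)
    (e f α ρ : ℝ) (he : e = x + 1 / 2) (hf : f = 1 + x - c)
    (hα : α = e * (e + 1) * f * (f + 1) / (x * (x + 1)))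
    (hρ : ρ = (x + 1 - 2 * c) * (e * (e + 1) * f * (f + 1)) /
      ((x + 1) ^ 2 * (x + 2 - 2 * c) * (x + 1 / 2 - c) * (x + 3 / 2 - c))) (k : ℝ) :
    α * ((x + k) * (x + k + 1)) - ρ * ((e + k) * (e + k + 1) * (f + k) * (f + k + 1)) =
      (x + k) * (1 / 2 + k) * (c + k) * (ρ / (x + 1 - 2 * c) * (k + 1 + e) * (k + 1 + f) +
          α * x / ((x + 3 / 2 - c) * (x + 1) * (x + 2 - 2 * c)) * (k + 1 + e) +
          -α / (2 * (x + 1) * (x + 3 / 2 - c)))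
        - k * (e + k + 1) * (f + k + 1) * (ρ / (x + 1 - 2 * c) * (k + e) * (k + f) +
          α * x / ((x + 3 / 2 - c) * (x + 1) * (x + 2 - 2 * c)) * (k + e) +
          -α / (2 * (x + 1) * (x + 3 / 2 - c))) := by
  have h1 : x + 1 - 2 * c ≠ 0 := by linarith
  have h2 : x + 2 - 2 * c ≠ 0 := by linarith
  have h3 : x * 2 + 1 - 2 * c ≠ 0 := by linarith
  have h4 : x * 2 + 3 - 2 * c ≠ 0 := by linarith
  have hαρ : α = ρ * ((x + 1) * (x + 2 - 2 * c) * (x + 1 / 2 - c) * (x + 3 / 2 - c)) /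
      ((x + 1 - 2 * c) * x) := by
    rw [hα, hρ]; field_simp
  rw [hαρ, he, hf]
  clear hα hρ hαρ
  field_simp
  ring

theorem whipple_certificate {e f : ℝ} (he : 0 < e) (hf : 0 < f) (hef : 1 < e + f) (x α ρ : ℝ)
    (hx : x = (e + f - 1) / 2)
    (hα : α = e * (e + 1) * f * (f + 1) / (x * (x + 1)))
    (hρ : ρ = e * (e + 1) * f * (f + 1) / ((e + 1 / 2) ^ 2 * (f + 1 / 2) ^ 2)) (k : ℝ) :
    α * ((x + k) * (x + k + 1)) - ρ * ((e + k) * (e + k + 1) * (f + k) * (f + k + 1)) =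
      (x + k) * (1 / 2 + k) * (1 / 2 + k) * (ρ / x * (k + 1 + e) * (k + 1 + f) +
          α * ((e + 1 / 2) ^ 2 + (f + 1 / 2) ^ 2 - e - f - 1) /
            (2 * (e + 1 / 2) ^ 2 * (f + 1 / 2) ^ 2) * (k + 1 + e) +
          α * (f - e - 1) / (2 * (e + 1 / 2) ^ 2))
        - k * (e + k + 1) * (f + k + 1) * (ρ / x * (k + e) * (k + f) +
          α * ((e + 1 / 2) ^ 2 + (f + 1 / 2) ^ 2 - e - f - 1) /
            (2 * (e + 1 / 2) ^ 2 * (f + 1 / 2) ^ 2) * (k + e) +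
          α * (f - e - 1) / (2 * (e + 1 / 2) ^ 2)) := by
  have hx0 : x ≠ 0 := by linarith
  have hx1 : x + 1 ≠ 0 := by linarith
  have hαρ : α = ρ * ((e + 1 / 2) ^ 2 * (f + 1 / 2) ^ 2) / (x * (x + 1)) := by
    rw [hα, hρ]; field_simp
  rw [hαρ]
  clear hα hρ hαρ
  field_simp
  rw [hx]
  ring

theorem tsum_hyperTerm_dixon {c : ℝ} (hc : 0 < c) (hc' : c < 3 / 4) :
    ∑' k, hyperTerm (1 / 2) (1 / 2) c 1 (3 / 2 - c) k =
      Gamma (5 / 4) * Gamma (3 / 4 - c) / (Gamma (3 / 4) * Gamma (5 / 4 - c)) *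
        (Gamma (3 / 2 - c) / (Gamma (3 / 2) * Gamma (1 - c))) := by
  have hΓ : ∀ {s : ℝ} (n : ℕ), 0 < s → 0 < Gamma (s + n) := fun n hs =>
    Gamma_pos_of_pos (by positivity)
  have h34 : 0 < 3 / 4 - c := by linarith
  have h54 : 0 < 5 / 4 - c := by linarith
  have h32 : 0 < 3 / 2 - c := by linarith
  have h1 : 0 < 1 - c := by linarith
  set H : ℕ → ℝ := fun n =>
    Gamma (5 / 4 + n) * Gamma (3 / 4 - c + n) / (Gamma (3 / 4 + n) * Gamma (5 / 4 - c + n)) *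
      (Gamma (1 + (2 * n : ℕ)) * Gamma (3 / 2 - c + (2 * n : ℕ)) /
        (Gamma (3 / 2 + (2 * n : ℕ)) * Gamma (1 - c + (2 * n : ℕ)))) with hH
  have hHpos : ∀ n, 0 < H n := by
    intro n
    have := hΓ n (by norm_num : (0 : ℝ) < 5 / 4)
    have := hΓ n (by norm_num : (0 : ℝ) < 3 / 4)
    have := hΓ n h34
    have := hΓ n h54
    have := hΓ (2 * n) one_pos
    have := hΓ (2 * n) (by norm_num : (0 : ℝ) < 3 / 2)
    have := hΓ (2 * n) h32
    have := hΓ (2 * n) h1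
    simp only [hH]
    positivity
  have hlim : Tendsto H atTop (𝓝 1) := by
    have hA := tendsto_Gamma_ratio (a := 5 / 4) (b := 3 / 4 - c) (c := 3 / 4) (d := 5 / 4 - c)
      (by norm_num) h34 (by norm_num) h54 (by ring)
    have hB := (tendsto_Gamma_ratio (a := 1) (b := 3 / 2 - c) (c := 3 / 2) (d := 1 - c)
      one_pos h32 (by norm_num) h1 (by ring)).comp (tendsto_id.const_mul_atTop' two_pos)
    have hAB := hA.mul hB
    rw [one_mul] at hAB
    exact hAB
  have hfin := tsum_hyperTerm_eq (x := 1 / 2) (y := 1 / 2) (z := c) (e := 1) (f := 3 / 2 - c)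
    (by norm_num) (by norm_num) hc (by norm_num) (by norm_num) (by linarith) h32 H
    (fun n => (hHpos n).ne') hlim ?_
  · rw [hfin]
    simp [hH]
  · intro n
    have hn : (0 : ℝ) ≤ n := n.cast_nonneg
    have hratio : H (n + 1) / H n =
        (1 / 2 + 2 * n + 1 - 2 * c) * ((1 + 2 * n) * (1 + 2 * n + 1) * (3 / 2 - c + 2 * n) *
          (3 / 2 - c + 2 * n + 1)) /
        ((1 / 2 + 2 * n + 1) ^ 2 * (1 / 2 + 2 * n + 2 - 2 * c) * (1 / 2 + 2 * n + 1 / 2 - c) *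
          (1 / 2 + 2 * n + 3 / 2 - c)) := by
      have hadd : ∀ {s : ℝ} (m : ℕ), 0 < s →
          Gamma (s + (m + 1 : ℕ)) = (s + m) * Gamma (s + m) := by
        intro s m hs
        push_cast
        rw [← add_assoc, Gamma_add_one (by positivity)]
      have h54' : (0 : ℝ) < 5 / 4 := by norm_num
      have h34' : (0 : ℝ) < 3 / 4 := by norm_num
      have h32' : (0 : ℝ) < 3 / 2 := by norm_num
      have g1 := hΓ n h54'
      have g2 := hΓ n h34'
      have g3 := hΓ n h34
      have g4 := hΓ n h54
      have g5 := hΓ (2 * n) one_pos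
      have g6 := hΓ (2 * n) h32'
      have g7 := hΓ (2 * n) h32
      have g8 := hΓ (2 * n) h1
      have d1 : 0 < 1 / 2 + 2 * (n : ℝ) + 2 - 2 * c := by linarith
      have d2 : 0 < 1 / 2 + 2 * (n : ℝ) + 1 / 2 - c := by linarith
      have d3 : 0 < 1 / 2 + 2 * (n : ℝ) + 3 / 2 - c := by linarith
      simp only [hH]
      rw [show 2 * (n + 1) = 2 * n + 1 + 1 by ring]
      rw [hadd n h54', hadd n h34', hadd n h34, hadd n h54, hadd _ one_pos, hadd _ h32',
        hadd _ h32, hadd _ h1, hadd _ one_pos, hadd _ h32', hadd _ h32, hadd _ h1]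
      generalize Gamma (5 / 4 + n) = G1 at *
      generalize Gamma (3 / 4 + n) = G2 at *
      generalize Gamma (3 / 4 - c + n) = G3 at *
      generalize Gamma (5 / 4 - c + n) = G4 at *
      generalize Gamma (1 + (2 * n : ℕ)) = G5 at *
      generalize Gamma (3 / 2 + (2 * n : ℕ)) = G6 at *
      generalize Gamma (3 / 2 - c + (2 * n : ℕ)) = G7 at *
      generalize Gamma (1 - c + (2 * n : ℕ)) = G8 at *
      push_cast
      rw [div_mul_div_comm, div_mul_div_comm, div_div_div_eq,
        div_eq_div_iff (by positivity) (by positivity)]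
      ring
    rw [hratio]
    exact tsum_hyperTerm_add_two (by positivity) (by norm_num) hc (by positivity) (by linarith)
      (by linarith) _ _ _ _ (dixon_certificate (by positivity) hc (by linarith) _ _ _ _ (by ring)
        (by ring) rfl rfl)

theorem tsum_hyperTerm_whipple {c : ℝ} (hc : 0 < c) (hc' : c ≤ 1) :
    ∑' k, hyperTerm c (1 / 2) (1 / 2) 1 (2 * c) k =
      Gamma (1 / 2) / Gamma (3 / 4) ^ 2 *
        (Gamma c * Gamma (c + 1 / 2) / Gamma (c + 1 / 4) ^ 2) := by
  have hΓ : ∀ {s : ℝ} (n : ℕ), 0 < s → 0 < Gamma (s + n) := fun n hs =>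
    Gamma_pos_of_pos (by positivity)
  have p12 : (0 : ℝ) < 1 / 2 := by norm_num
  have p34 : (0 : ℝ) < 3 / 4 := by norm_num
  have pc2 : 0 < c + 1 / 2 := by linarith
  have pc4 : 0 < c + 1 / 4 := by linarith
  set H : ℕ → ℝ := fun n =>
    Gamma (1 / 2 + n) * Gamma (1 + n) / (Gamma (3 / 4 + n) * Gamma (3 / 4 + n)) *
      (Gamma (c + n) * Gamma (c + 1 / 2 + n) / (Gamma (c + 1 / 4 + n) * Gamma (c + 1 / 4 + n)))
    with hH
  have hHpos : ∀ n, 0 < H n := by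
    intro n
    have := hΓ n p12
    have := hΓ n one_pos
    have := hΓ n p34
    have := hΓ n hc
    have := hΓ n pc2
    have := hΓ n pc4
    simp only [hH]
    positivity
  have hlim : Tendsto H atTop (𝓝 1) := by
    have hAB := (tendsto_Gamma_ratio p12 one_pos p34 p34 (by norm_num)).mul
      (tendsto_Gamma_ratio hc pc2 pc4 pc4 (by ring))
    rw [one_mul] at hAB
    exact hAB
  have hfin := tsum_hyperTerm_eq (x := c) (y := 1 / 2) (z := 1 / 2) (e := 1) (f := 2 * c)
    hc p12 p12 hc' (by norm_num) (by norm_num) (by positivity) H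
    (fun n => (hHpos n).ne') hlim ?_
  · rw [hfin]
    simp [hH, pow_two]
  · intro n
    have hratio : H (n + 1) / H n =
        (1 + 2 * n) * (1 + 2 * n + 1) * (2 * c + 2 * n) * (2 * c + 2 * n + 1) /
          ((1 + 2 * n + 1 / 2) ^ 2 * (2 * c + 2 * n + 1 / 2) ^ 2) := by
      have hadd : ∀ {s : ℝ}, 0 < s → Gamma (s + (n + 1 : ℕ)) = (s + n) * Gamma (s + n) := by
        intro s hs
        push_cast
        rw [← add_assoc, Gamma_add_one (by positivity)]
      have := hΓ n p12
      have := hΓ n one_pos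
      have := hΓ n p34
      have := hΓ n hc
      have := hΓ n pc2
      have := hΓ n pc4
      simp only [hH]
      rw [hadd p12, hadd one_pos, hadd p34, hadd hc, hadd pc2, hadd pc4]
      field_simp
      ring
    rw [hratio]
    refine tsum_hyperTerm_add_two (by positivity) p12 p12 (by positivity) (by positivity)
      (by linarith) _ _ _ _ (whipple_certificate (by positivity) (by positivity) ?_ _ _ _ ?_
        rfl rfl)
    · linarith [n.cast_nonneg (α := ℝ)]
    · ring

theorem F32_eq_tsum_hyperTerm (x y z e f : ℝ) :
    F32 x y z e f 1 = ∑' k, hyperTerm x y z e f k := by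
  simp [F32, hyperTerm]

theorem hyperTerm_rotate (x y z e f : ℝ) (k : ℕ) :
    hyperTerm x y z e f k = hyperTerm z x y e f k := by
  simp only [hyperTerm]
  congr 1
  ring

theorem P_dixon {c : ℝ} (hc : 0 < c) (hc' : c < 3 / 4) :
    P c (3 / 2 - c) = √π * Gamma (5 / 4) / (Gamma (3 / 4) * Gamma (3 / 2)) *
      (Gamma c / Gamma (1 - c)) * Gamma (3 / 4 - c) ^ 2 * 2 ^ (1 / 2 - 2 * c) := by
  have hdup := Gamma_mul_Gamma_add_half (3 / 4 - c)
  rw [show 3 / 4 - c + 1 / 2 = 5 / 4 - c by ring, show 2 * (3 / 4 - c) = 3 / 2 - 2 * c by ring,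
    show 1 - (3 / 2 - 2 * c) = -(1 / 2 - 2 * c) by ring, rpow_neg zero_le_two] at hdup
  have h1 : 0 < Gamma (5 / 4 - c) := Gamma_pos_of_pos (by linarith)
  have h2 : 0 < Gamma (3 / 2 - c) := Gamma_pos_of_pos (by linarith)
  have h3 : 0 < Gamma (1 - c) := Gamma_pos_of_pos (by linarith)
  have h4 : 0 < Gamma (3 / 4) := Gamma_pos_of_pos (by norm_num)
  have h5 : 0 < Gamma (3 / 2) := Gamma_pos_of_pos (by norm_num)
  have h6 : (0 : ℝ) < 2 ^ (1 / 2 - 2 * c) := by positivity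
  have hpi : 0 < √π := sqrt_pos.2 pi_pos
  have hpi2 : √π * √π = π := mul_self_sqrt pi_pos.le
  have hG : Gamma (3 / 2 - 2 * c) =
      Gamma (3 / 4 - c) * Gamma (5 / 4 - c) * 2 ^ (1 / 2 - 2 * c) / √π := by
    rw [hdup]; field_simp
  rw [P, F32_eq_tsum_hyperTerm, tsum_hyperTerm_dixon hc hc', betaR,
    show c + (3 / 2 - c - c) = 3 / 2 - c by ring, show 3 / 2 - c - c = 3 / 2 - 2 * c by ring, hG]
  nth_rewrite 1 [← hpi2]
  generalize Gamma (5 / 4 - c) = g₁ at *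
  generalize Gamma (3 / 2 - c) = g₂ at *
  generalize Gamma (3 / 4 - c) = g₃ at *
  field_simp

theorem P_whipple {c : ℝ} (hc : 0 < c) (hc' : c ≤ 1) :
    P c (2 * c) = π ^ 2 * Gamma c ^ 2 * 2 ^ (1 - 2 * c) /
      (Gamma (3 / 4) ^ 2 * Gamma (c + 1 / 4) ^ 2) := by
  have hdup := Gamma_mul_Gamma_add_half c
  have h1 : 0 < Gamma (2 * c) := Gamma_pos_of_pos (by linarith)
  have h2 : 0 < Gamma (3 / 4) := Gamma_pos_of_pos (by norm_num)
  have h3 : 0 < Gamma (c + 1 / 4) := Gamma_pos_of_pos (by linarith)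
  have hpi2 : √π * √π = π := mul_self_sqrt pi_pos.le
  rw [P, F32_eq_tsum_hyperTerm, tsum_congr (hyperTerm_rotate _ _ _ _ _),
    tsum_hyperTerm_whipple hc hc', betaR, hdup, Gamma_one_half_eq,
    show 2 * c - c = c by ring, show c + c = 2 * c by ring]
  field_simp
  rw [pow_two √π, hpi2]

theorem sqrt_two_mul_sin_pi_div_twelve : √2 * sin (π / 12) = (√3 - 1) / 2 := by
  have h22 : √2 ^ 2 = (2 : ℝ) := sq_sqrt zero_le_two
  rw [show π / 12 = π / 3 - π / 4 by ring, sin_sub, sin_pi_div_three, cos_pi_div_three,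
    sin_pi_div_four, cos_pi_div_four]
  linear_combination (√3 - 1) / 4 * h22

theorem Gamma_one_third_mul_Gamma_two_thirds :
    √3 * (Gamma (1 / 3) * Gamma (2 / 3)) = 2 * π := by
  have h := Gamma_mul_Gamma_one_sub (1 / 3)
  rw [show π * (1 / 3) = π / 3 by ring, sin_pi_div_three,
    show (1 : ℝ) - 1 / 3 = 2 / 3 by norm_num] at h
  rw [h]
  field_simp

theorem Gamma_one_twelfth_mul_Gamma_eleven_twelfths :
    (√3 - 1) * (Gamma (1 / 12) * Gamma (11 / 12)) = 2 * √2 * π := by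
  have h := Gamma_mul_Gamma_one_sub (1 / 12)
  have hsin : 0 < sin (π / 12) := sin_pos_of_pos_of_lt_pi (by positivity) (by linarith [pi_pos])
  rw [show π * (1 / 12) = π / 12 by ring, show (1 : ℝ) - 1 / 12 = 11 / 12 by norm_num] at h
  rw [h, show √3 - 1 = 2 * (√2 * sin (π / 12)) by rw [sqrt_two_mul_sin_pi_div_twelve]; ring]
  field_simp

theorem Gamma_one_third_mul_Gamma_five_twelfths :
    2 * (Gamma (1 / 3) * Gamma (5 / 12)) = (√3 - 1) * (Gamma (2 / 3) * Gamma (1 / 12)) := by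
  have hd : 0 < Gamma (11 / 12) := Gamma_pos_of_pos (by norm_num)
  have h₁ := Gamma_mul_Gamma_add_half (5 / 12)
  have h₂ := Gamma_mul_Gamma_add_half (1 / 3)
  have h₃ := Gamma_one_twelfth_mul_Gamma_eleven_twelfths
  norm_num at h₁ h₂ h₃
  have hpi : √π ^ 2 = π := sq_sqrt pi_pos.le
  have hpow : (2 : ℝ) ^ (1 / 6 : ℝ) * 2 ^ (2 / 3 - 1 / 3 : ℝ) = √2 := by
    rw [sqrt_eq_rpow, ← rpow_add two_pos]
    norm_num
  norm_num at hpow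
  refine mul_right_cancel₀ hd.ne' ?_
  linear_combination 2 * Gamma (1 / 3) * h₁ + 2 * 2 ^ (1 / 6 : ℝ) * √π * h₂
    - Gamma (2 / 3) * h₃ + 2 * Gamma (2 / 3) * √π ^ 2 * hpow + 2 * Gamma (2 / 3) * √2 * hpi

/-- `2^{1/3} · P(1/3, 7/6) = (2 − √3) · P(2/3, 5/6) = √3 · P(2/3, 4/3)`. -/
theorem P_relation_seven_sixths :
    (2 : ℝ) ^ ((1 : ℝ)/3) * P (1/3) (7/6) = (2 - Real.sqrt 3) * P (2/3) (5/6) ∧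
    (2 - Real.sqrt 3) * P (2/3) (5/6) = Real.sqrt 3 * P (2/3) (4/3) := by
  have hs : (0 : ℝ) < √3 := by positivity
  have hss : √3 ^ 2 = 3 := sq_sqrt (by norm_num)
  have hπ := pi_pos
  have hA : 0 < Gamma (1 / 3) := Gamma_pos_of_pos (by norm_num)
  have hB : 0 < Gamma (2 / 3) := Gamma_pos_of_pos (by norm_num)
  have hd : 0 < Gamma (11 / 12) := Gamma_pos_of_pos (by norm_num)
  have hG : 0 < Gamma (3 / 4) := Gamma_pos_of_pos (by norm_num)
  have hAB := Gamma_one_third_mul_Gamma_two_thirds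
  have had := Gamma_one_twelfth_mul_Gamma_eleven_twelfths
  have hAb := Gamma_one_third_mul_Gamma_five_twelfths
  have hK : √π * Gamma (5 / 4) / (Gamma (3 / 4) * Gamma (3 / 2)) =
      π * √2 / (2 * Gamma (3 / 4) ^ 2) := by
    have h14 := Gamma_mul_Gamma_one_sub (1 / 4)
    rw [show π * (1 / 4) = π / 4 by ring, sin_pi_div_four, show (1 : ℝ) - 1 / 4 = 3 / 4 by norm_num]
      at h14
    have h54 : Gamma (5 / 4) = 1 / 4 * Gamma (1 / 4) := by
      rw [← Gamma_add_one (by norm_num)]; norm_num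
    have h32 : Gamma (3 / 2) = 1 / 2 * √π := by
      rw [← Gamma_one_half_eq, ← Gamma_add_one (by norm_num)]; norm_num
    have h14' : Gamma (1 / 4) = π / (√2 / 2) / Gamma (3 / 4) := by
      rw [← h14]; field_simp
    have h22 : √2 ^ 2 = (2 : ℝ) := sq_sqrt zero_le_two
    rw [h54, h32, h14']
    field_simp
    linarith
  have hP₁ := P_dixon (c := 1 / 3) (by norm_num) (by norm_num)
  have hP₂ := P_dixon (c := 2 / 3) (by norm_num) (by norm_num)
  have hP₃ := P_whipple (c := 2 / 3) (by norm_num) (by norm_num)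
  rw [hK] at hP₁ hP₂
  norm_num at hP₁ hP₂ hP₃
  have hpow : (2 : ℝ) ^ (1 / 3 : ℝ) * 2 ^ (-(1 / 6) : ℝ) = 2 * 2 ^ (-(5 / 6) : ℝ) := by
    nth_rewrite 3 [← rpow_one 2]
    rw [← rpow_add two_pos, ← rpow_add two_pos]
    norm_num
  have hpow' : (2 : ℝ) ^ (-(1 / 3) : ℝ) = √2 * 2 ^ (-(5 / 6) : ℝ) := by
    rw [sqrt_eq_rpow, ← rpow_add two_pos]
    norm_num
  have h22 : √2 ^ 2 = (2 : ℝ) := sq_sqrt zero_le_two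
  rw [hP₁, hP₂, hP₃, hpow']
  have hq : (0 : ℝ) < 2 ^ (-(5 / 6) : ℝ) := by positivity
  generalize (2 : ℝ) ^ (-(5 / 6) : ℝ) = q at *
  generalize (2 : ℝ) ^ (-(1 / 6) : ℝ) = p at *
  generalize (2 : ℝ) ^ (1 / 3 : ℝ) = r at *
  generalize Gamma (1 / 3) = A at *
  generalize Gamma (2 / 3) = B at *
  generalize Gamma (1 / 12) = a at *
  generalize Gamma (5 / 12) = b at *
  generalize Gamma (11 / 12) = d at *
  generalize Gamma (3 / 4) = G at *
  have hfirst : 2 * (A ^ 2 * b ^ 2) = (2 - √3) * (B ^ 2 * a ^ 2) := by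
    linear_combination (2 * (A * b) + (√3 - 1) * (B * a)) / 2 * hAb + B ^ 2 * a ^ 2 / 2 * hss
  have hsecond : (2 - √3) * (a ^ 2 * d ^ 2) = 2 * √3 * π * (A * B) := by
    linear_combination ((√3 - 1) * (a * d) + 2 * √2 * π) / 2 * had - a ^ 2 * d ^ 2 / 2 * hss
      + 2 * π ^ 2 * h22 - 2 * π * hAB
  constructor
  · calc r * (π * √2 / (2 * G ^ 2) * (A / B) * b ^ 2 * p)
        = π * √2 / (2 * G ^ 2) * (A / B) * b ^ 2 * (r * p) := by ring
      _ = π * √2 * q / (2 * G ^ 2 * A * B) * (2 * (A ^ 2 * b ^ 2)) := by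
        rw [hpow]; field_simp
      _ = (2 - √3) * (π * √2 / (2 * G ^ 2) * (B / A) * a ^ 2 * q) := by
        rw [hfirst]; field_simp
  · calc (2 - √3) * (π * √2 / (2 * G ^ 2) * (B / A) * a ^ 2 * q)
        = π * √2 * q * B / (2 * G ^ 2 * A * d ^ 2) * ((2 - √3) * (a ^ 2 * d ^ 2)) := by
          field_simp
      _ = √3 * (π ^ 2 * B ^ 2 * (√2 * q) / (G ^ 2 * d ^ 2)) := by
        rw [hsecond]; field_simp
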